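/- Let L_1, …, L_N be real n×n matrices satisfying the Garden Algebra with R_I := L_Iᵀ, i.e. L_I * L_Jᵀ + L_J * L_Iᵀ = 2·δ_{IJ}·1_n and L_Iᵀ * L_J + L_Jᵀ * L_I = 2·δ_{IJ}·1_n for all I, J. Define 2n×2n block matrices L̂_I := [[L_I, 0], [0, L_Iᵀ]] for I = 1, …, N, and L̂_{N+1} := [[0, 1_n], [−1_n, 0]]. Then the family L̂_1, …, L̂_{N+1}, with R̂_I := L̂_Iᵀ, satisfies the Garden Algebra: L̂_I * L̂_Jᵀ + L̂_J * L̂_Iᵀ = 2·δ_{IJ}·1_{2n} and L̂_Iᵀ * L̂_J + L̂_Jᵀ * L̂_I = 2·δ_{IJ}·1_{2n} for all I, J ∈ {1, …, N+1}. -/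

import Mathlib

open Matrix

theorem lifting_preserves_garden_algebra (n N : ℕ)
    (L : Fin N → Matrix (Fin n) (Fin n) ℝ)
    (hB : ∀ I J : Fin N, L I * (L J)ᵀ + L J * (L I)ᵀ =
      if I = J then (2 : ℝ) • (1 : Matrix (Fin n) (Fin n) ℝ) else 0)
    (hF : ∀ I J : Fin N, (L I)ᵀ * L J + (L J)ᵀ * L I =
      if I = J then (2 : ℝ) • (1 : Matrix (Fin n) (Fin n) ℝ) else 0)
    (Lhat : Fin (N + 1) → Matrix (Fin n ⊕ Fin n) (Fin n ⊕ Fin n) ℝ)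
    (hdef : ∀ I : Fin N, Lhat I.castSucc = Matrix.fromBlocks (L I) 0 0 (L I)ᵀ)
    (hlast : Lhat (Fin.last N) = Matrix.fromBlocks 0 1 (-1) 0) :
    (∀ I J : Fin (N + 1), Lhat I * (Lhat J)ᵀ + Lhat J * (Lhat I)ᵀ =
      if I = J then (2 : ℝ) • (1 : Matrix (Fin n ⊕ Fin n) (Fin n ⊕ Fin n) ℝ) else 0) ∧
    (∀ I J : Fin (N + 1), (Lhat I)ᵀ * Lhat J + (Lhat J)ᵀ * Lhat I =
      if I = J then (2 : ℝ) • (1 : Matrix (Fin n ⊕ Fin n) (Fin n ⊕ Fin n) ℝ) else 0) := by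
  have h_one : (2 : ℝ) • (1 : Matrix (Fin n ⊕ Fin n) (Fin n ⊕ Fin n) ℝ) =
      fromBlocks ((2 : ℝ) • 1) 0 0 ((2 : ℝ) • 1) := by
    rw [← fromBlocks_one, fromBlocks_smul, smul_zero]
  constructor <;> intro I J <;>
    cases I using Fin.lastCases with
    | last =>
      cases J using Fin.lastCases with
      | last =>
        rw [hlast, if_pos rfl]
        simp [fromBlocks_transpose, fromBlocks_multiply, two_smul]
      | cast J =>
        rw [hlast, hdef, if_neg (Fin.castSucc_ne_last J).symm]
        simp [fromBlocks_transpose, fromBlocks_multiply, fromBlocks_add]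
    | cast I =>
      cases J using Fin.lastCases with
      | last =>
        rw [hlast, hdef, if_neg (Fin.castSucc_ne_last I)]
        simp [fromBlocks_transpose, fromBlocks_multiply, fromBlocks_add]
      | cast J =>
        simp only [hdef, fromBlocks_transpose, fromBlocks_multiply, fromBlocks_add,
          transpose_transpose, transpose_zero, mul_zero, zero_mul, add_zero, zero_add, hB, hF,
          Fin.castSucc_inj]
        split_ifs
        · exact h_one.symm
        · exact fromBlocks_zero
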